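/- Let f : [0,1] → ℝ be continuously differentiable. Then the Riemann sums of positive increments over uniform partitions converge to the integrated positive part of the derivative: the sequence n ↦ Σ_{ℓ=0}^{n−1} max(0, f((ℓ+1)/n) − f(ℓ/n)) tends to ∫₀¹ max(0, f′(t)) dt as n → ∞. -/

import Mathlib

open Filter

/-- If `f'` oscillates by at most `ε` on `[a, b]`, then the positive part of the increment of `f`
differs from the integral of the positive part of `f'` by at most `ε * (b - a)`. -/
lemma abs_max_sub_integral_max_le {f f' : ℝ → ℝ} {a b ε : ℝ} (hab : a < b)
    (hf : ∀ t ∈ Set.Icc a b, HasDerivWithinAt f (f' t) (Set.Icc a b) t)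
    (hf' : ContinuousOn f' (Set.Icc a b))
    (hε : ∀ x ∈ Set.Icc a b, ∀ y ∈ Set.Icc a b, |f' x - f' y| ≤ ε) :
    |max 0 (f b - f a) - ∫ t in a..b, max 0 (f' t)| ≤ ε * (b - a) := by
  obtain ⟨c, hc, hfc⟩ := exists_hasDerivAt_eq_slope f f' hab
    (fun t ht => (hf t ht).continuousWithinAt)
    (fun t ht => (hf t (Set.Ioo_subset_Icc_self ht)).hasDerivAt (Icc_mem_nhds ht.1 ht.2))
  have hba : 0 < b - a := sub_pos.2 hab
  have hincr : max 0 (f b - f a) = ∫ _ in a..b, max 0 (f' c) := by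
    rw [intervalIntegral.integral_const, smul_eq_mul, mul_max_of_nonneg _ _ hba.le, hfc]
    field_simp
    simp
  have hint : IntervalIntegrable (fun t => max 0 (f' t)) MeasureTheory.volume a b :=
    ContinuousOn.intervalIntegrable_of_Icc hab.le (continuousOn_const.sup hf')
  rw [hincr, ← intervalIntegral.integral_sub intervalIntegrable_const hint, ← Real.norm_eq_abs,
    ← abs_of_pos hba]
  refine intervalIntegral.norm_integral_le_of_norm_le_const fun t ht => ?_
  rw [Set.uIoc_of_le hab.le] at ht
  rw [Real.norm_eq_abs, max_comm 0 (f' c), max_comm 0 (f' t)]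
  exact (abs_max_sub_max_le_abs _ _ _).trans
    (hε c (Set.Ioo_subset_Icc_self hc) t (Set.Ioc_subset_Icc_self ht))

/-- For a continuously differentiable `f : [0,1] → ℝ` (with derivative
`f'` continuous on `[0,1]`), the sums of positive increments over the
uniform partition with `n` pieces converge, as `n → ∞`, to the integral
of the positive part of the derivative. -/
theorem stmt_11 (f f' : ℝ → ℝ)
    (hf : ∀ t ∈ Set.Icc (0 : ℝ) 1, HasDerivWithinAt f (f' t) (Set.Icc 0 1) t)
    (hf' : ContinuousOn f' (Set.Icc 0 1)) :
    Tendsto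
      (fun n : ℕ => ∑ ℓ ∈ Finset.range n,
        max 0 (f ((ℓ + 1 : ℝ) / n) - f ((ℓ : ℝ) / n)))
      atTop (nhds (∫ t in (0 : ℝ)..1, max 0 (f' t))) := by
  rw [Metric.tendsto_atTop]
  intro ε hε
  obtain ⟨δ, hδ, huc⟩ := Metric.uniformContinuousOn_iff.1
    (isCompact_Icc.uniformContinuousOn_of_continuous hf') (ε / 2) (half_pos hε)
  obtain ⟨N, hN⟩ := exists_nat_one_div_lt hδ
  refine ⟨N + 1, fun n hn => ?_⟩
  have hn0 : (0 : ℝ) < n := by exact_mod_cast (Nat.succ_pos N).trans_le hn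
  have hnδ : 1 / (n : ℝ) < δ :=
    (one_div_le_one_div_of_le (by positivity) (by exact_mod_cast hn)).trans_lt hN
  have hlen (ℓ : ℕ) : ((ℓ : ℝ) + 1) / n - ℓ / n = 1 / n := by ring
  have hlt (ℓ : ℕ) : (ℓ : ℝ) / n < (ℓ + 1) / n := by
    have := hlen ℓ
    have : 0 < 1 / (n : ℝ) := by positivity
    linarith
  have hsub {ℓ : ℕ} (hℓ : ℓ < n) :
      Set.Icc ((ℓ : ℝ) / n) ((ℓ + 1) / n) ⊆ Set.Icc 0 1 := by
    refine Set.Icc_subset_Icc (by positivity) ((div_le_one hn0).2 ?_)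
    exact_mod_cast hℓ
  have hsplit : ∫ t in (0 : ℝ)..1, max 0 (f' t) =
      ∑ ℓ ∈ Finset.range n, ∫ t in ((ℓ : ℝ) / n)..((ℓ + 1) / n), max 0 (f' t) := by
    have h := intervalIntegral.sum_integral_adjacent_intervals (n := n)
      (μ := MeasureTheory.volume) (f := fun t => max 0 (f' t)) (a := fun ℓ : ℕ => (ℓ : ℝ) / n)
      (fun ℓ hℓ => by
        push_cast
        exact ContinuousOn.intervalIntegrable_of_Icc (hlt ℓ).le
          ((continuousOn_const.sup hf').mono (hsub hℓ)))
    push_cast at h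
    rw [h, zero_div, div_self hn0.ne']
  rw [Real.dist_eq, hsplit, ← Finset.sum_sub_distrib]
  calc _ ≤ ∑ ℓ ∈ Finset.range n, |max 0 (f ((ℓ + 1 : ℝ) / n) - f ((ℓ : ℝ) / n)) -
          ∫ t in ((ℓ : ℝ) / n)..((ℓ + 1) / n), max 0 (f' t)| := Finset.abs_sum_le_sum_abs _ _
    _ ≤ ∑ _ℓ ∈ Finset.range n, ε / 2 * (1 / n) := by
        refine Finset.sum_le_sum fun ℓ hℓ => ?_
        have hs := hsub (Finset.mem_range.1 hℓ)
        rw [← hlen ℓ]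
        refine abs_max_sub_integral_max_le (hlt ℓ) (fun t ht => (hf t (hs ht)).mono hs)
          (hf'.mono hs) fun x hx y hy => (huc x (hs hx) y (hs hy) ?_).le
        exact (Real.dist_le_of_mem_Icc hx hy).trans_lt (by rwa [hlen])
    _ = ε / 2 := by
        rw [Finset.sum_const, Finset.card_range, nsmul_eq_mul]
        field_simp
    _ < ε := half_lt_self hε
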